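/- Let Θ ⊂ ℝ^q be compact and convex, μ a σ-finite measure on ℝ^J, and (f(·;θ))_{θ∈Θ} a jointly measurable family of strictly positive probability densities with respect to μ, continuously differentiable in θ, with sup_{θ'∈Θ} E_{θ'}[sup_{θ∈Θ} (log f(y;θ))²] < ∞ and sup_{θ'∈Θ} E_{θ'}[sup_{θ∈Θ} ‖∇_θ log f(y;θ)‖²] < ∞, where E_{θ'} is expectation when y has density f(·;θ'); assume moreover θ ↦ E_{θ₀}[log f(y;θ)] is continuous on Θ. On a probability space (Ω, 𝔉, P), let θ*_N : Ω → Θ be random parameters converging in probability to θ₀ ∈ Θ, and for each N and ω let P*_{N,ω} = (f(·;θ*_N(ω))·μ)^{⊗N} be the law of the bootstrap sample y*_1,…,y*_N. Then the uniform bootstrap law of large numbers holds: for all ε > 0 and η > 0, P({ω : P*_{N,ω}( sup_{θ∈Θ} |(1/N) Σ_{i=1}^N log f(y*_i;θ) − E_{θ₀}[log f(y;θ)]| > ε ) > η}) → 0 as N → ∞. -/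

import Mathlib

open MeasureTheory Filter

/-- The probability measure with density `f(·;θ)` with respect to `μ`. -/
noncomputable def densMeasure {E : Type*} [MeasurableSpace E] (μ : Measure E) {q : ℕ}
    (f : E → EuclideanSpace ℝ (Fin q) → ℝ) (θ : EuclideanSpace ℝ (Fin q)) : Measure E :=
  μ.withDensity fun y => ENNReal.ofReal (f y θ)

/-- The law `P*_{N} = (f(·;θ)·μ)^{⊗N}` of an i.i.d. bootstrap sample of size `N` drawn
from the density `f(·;θ)`. -/
noncomputable def bootLaw {E : Type*} [MeasurableSpace E] (μ : Measure E) {q : ℕ}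
    (f : E → EuclideanSpace ℝ (Fin q) → ℝ)
    [∀ θ, SigmaFinite (densMeasure μ f θ)]
    (N : ℕ) (θ : EuclideanSpace ℝ (Fin q)) : Measure (Fin N → E) :=
  Measure.pi fun _ : Fin N => densMeasure μ f θ

/-!
Uniform bootstrap law of large numbers: if the bootstrap parameter `θ*_N` converges in
probability to `θ₀` and bootstrap samples of size `N` are drawn i.i.d. from the density
`f(·;θ*_N)`, then the bootstrap empirical log-likelihood criterion converges uniformly
over the compact convex parameter set `Θ` to the population criterion
`θ ↦ E_{θ₀}[log f(y;θ)]`, in conditional probability.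
-/

lemma sqInt_aux {E : Type*} [MeasurableSpace E] (ν : Measure E) (g : E → ℝ) (hg : Measurable g)
    (K : ℝ) (hK : 0 ≤ K) (h : ∫⁻ z, ENNReal.ofReal (g z ^ 2) ∂ν ≤ ENNReal.ofReal K) :
    Integrable (fun z => g z ^ 2) ν ∧ ∫ z, g z ^ 2 ∂ν ≤ K := by
  have h0 : 0 ≤ᵐ[ν] fun z => g z ^ 2 := Eventually.of_forall fun z => sq_nonneg _
  have hm : AEStronglyMeasurable (fun z => g z ^ 2) ν := (hg.pow_const 2).aestronglyMeasurable
  refine ⟨⟨hm, ?_⟩, ?_⟩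
  · rw [hasFiniteIntegral_iff_ofReal h0]
    exact h.trans_lt ENNReal.ofReal_lt_top
  · rw [integral_eq_lintegral_of_nonneg_ae h0 hm]
    exact ENNReal.toReal_le_of_le_ofReal hK h

lemma cheb_aux {E : Type*} [MeasurableSpace E] (ν : Measure E) [IsProbabilityMeasure ν]
    (g : E → ℝ) (hg : Measurable g) (K : ℝ)
    (hi : Integrable (fun z => g z ^ 2) ν) (hK : ∫ z, g z ^ 2 ∂ν ≤ K)
    (N : ℕ) (hN : 0 < N) (c : ℝ) (hc : 0 < c) :
    Measure.pi (fun _ : Fin N => ν)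
      {ys | c ≤ |(N : ℝ)⁻¹ * ∑ i, g (ys i) - ∫ z, g z ∂ν|} ≤
      ENNReal.ofReal (K / (N * c ^ 2)) := by
  have hN' : (0 : ℝ) < N := by exact_mod_cast hN
  have hL : MemLp g 2 ν := (memLp_two_iff_integrable_sq hg.aestronglyMeasurable).2 hi
  have hgi : Integrable g ν := hL.integrable (by norm_num)
  have hLi : ∀ i : Fin N, MemLp (fun ys : Fin N → E => g (ys i)) 2
      (Measure.pi (fun _ : Fin N => ν)) := fun i =>
    hL.comp_measurePreserving (measurePreserving_eval (fun _ : Fin N => ν) i)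
  have hS : MemLp (∑ i : Fin N, fun ys : Fin N → E => g (ys i)) 2
      (Measure.pi (fun _ : Fin N => ν)) := memLp_finsetSum' _ fun i _ => hLi i
  have hmean : ∫ ys, (∑ i : Fin N, fun ys : Fin N → E => g (ys i)) ys
      ∂(Measure.pi (fun _ : Fin N => ν)) = N * ∫ z, g z ∂ν := by
    simp only [Finset.sum_apply]
    rw [integral_finsetSum _ fun i _ => (hLi i).integrable (by norm_num)]
    have : ∀ i : Fin N, ∫ ys : Fin N → E, g (ys i) ∂(Measure.pi (fun _ : Fin N => ν))
        = ∫ z, g z ∂ν := fun i => integral_comp_eval (μ := fun _ : Fin N => ν) hgi.1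
    simp [this]
  have hvar := ProbabilityTheory.variance_sum_pi (μ := fun _ : Fin N => ν)
    (X := fun _ => g) fun i => hL
  have hch := ProbabilityTheory.meas_ge_le_variance_div_sq hS (c := N * c) (by positivity)
  rw [hmean, hvar] at hch
  have hv := (ProbabilityTheory.variance_le_expectation_sq (X := g) (μ := ν) hgi.1).trans hK
  refine (measure_mono ?_).trans (hch.trans (ENNReal.ofReal_le_ofReal ?_))
  · intro ys hys
    simp only [Set.mem_ofPred_eq, Finset.sum_apply] at hys ⊢
    have : ∑ i, g (ys i) - N * ∫ z, g z ∂ν =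
        N * ((N : ℝ)⁻¹ * ∑ i, g (ys i) - ∫ z, g z ∂ν) := by field_simp
    rw [this, abs_mul, abs_of_pos hN']
    gcongr
  · simp only [Finset.sum_const, Finset.card_univ, Fintype.card_fin, nsmul_eq_mul]
    rw [show K / (N * c ^ 2) = N * K / (N * c) ^ 2 by field_simp]
    gcongr

lemma markov_aux {E : Type*} [MeasurableSpace E] (ν : Measure E) [IsProbabilityMeasure ν]
    (g : E → ℝ) (hg : Integrable g ν) (h0 : ∀ z, 0 ≤ g z)
    (N : ℕ) (hN : 0 < N) (c : ℝ) (hc : 0 < c) :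
    Measure.pi (fun _ : Fin N => ν) {ys | c ≤ (N : ℝ)⁻¹ * ∑ i, g (ys i)} ≤
      ENNReal.ofReal ((∫ z, g z ∂ν) / c) := by
  have hN' : (0 : ℝ) < N := by exact_mod_cast hN
  have hint : ∀ i : Fin N, Integrable (fun ys : Fin N → E => g (ys i))
      (Measure.pi (fun _ : Fin N => ν)) := fun i =>
    integrable_comp_eval (μ := fun _ : Fin N => ν) hg
  have hI : Integrable (fun ys : Fin N → E => (N : ℝ)⁻¹ * ∑ i, g (ys i))
      (Measure.pi (fun _ : Fin N => ν)) :=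
    (integrable_finsetSum _ fun i _ => hint i).const_mul _
  have hm := mul_meas_ge_le_integral_of_nonneg (Eventually.of_forall fun ys =>
    mul_nonneg (inv_nonneg.2 hN'.le) (Finset.sum_nonneg fun i _ => h0 (ys i))) hI c
  rw [integral_const_mul, integral_finsetSum _ fun i _ => hint i] at hm
  have : ∀ i : Fin N, ∫ ys : Fin N → E, g (ys i) ∂(Measure.pi (fun _ : Fin N => ν))
        = ∫ z, g z ∂ν := fun i => integral_comp_eval (μ := fun _ : Fin N => ν) hg.1
  simp only [this, Finset.sum_const, Finset.card_univ, Fintype.card_fin, nsmul_eq_mul] at hm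
  rw [inv_mul_cancel_left₀ hN'.ne'] at hm
  rw [← ENNReal.ofReal_toReal (measure_ne_top (Measure.pi (fun _ : Fin N => ν)) _)]
  apply ENNReal.ofReal_le_ofReal
  rw [le_div_iff₀ hc, mul_comm]
  exact hm

/-- Scheffe. -/
lemma scheffe_aux {E : Type*} [MeasurableSpace E] (μ : Measure E) {q : ℕ}
    (f : E → EuclideanSpace ℝ (Fin q) → ℝ) (Θ : Set (EuclideanSpace ℝ (Fin q)))
    (θ₀ : EuclideanSpace ℝ (Fin q)) (hθ₀ : θ₀ ∈ Θ)
    (hpos : ∀ z θ, 0 < f z θ)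
    (hint : ∀ θ ∈ Θ, Integrable (fun z => f z θ) μ)
    (hprob : ∀ θ ∈ Θ, ∫ z, f z θ ∂μ = 1)
    (hc : ∀ z, ContinuousOn (f z) Θ) :
    Tendsto (fun θ => ∫ z, |f z θ - f z θ₀| ∂μ) (nhdsWithin θ₀ Θ) (nhds 0) := by
  have h1 : Tendsto (fun θ => ∫ z, max (f z θ₀ - f z θ) 0 ∂μ) (nhdsWithin θ₀ Θ)
      (nhds (∫ _z, (0 : ℝ) ∂μ)) := by
    refine tendsto_integral_filter_of_dominated_convergence (fun z => f z θ₀) ?_ ?_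
      (hint θ₀ hθ₀) ?_
    · filter_upwards [self_mem_nhdsWithin] with θ hθ
      exact ((hint θ₀ hθ₀).sub (hint θ hθ)).pos_part.1
    · filter_upwards with θ
      filter_upwards with z
      rw [Real.norm_of_nonneg (le_max_right _ _)]
      exact max_le (by linarith [hpos z θ]) (hpos z θ₀).le
    · filter_upwards with z
      have : Tendsto (fun θ => max (f z θ₀ - f z θ) 0) (nhdsWithin θ₀ Θ)
          (nhds (max (f z θ₀ - f z θ₀) 0)) :=
        (tendsto_const_nhds.sub (hc z θ₀ hθ₀)).max tendsto_const_nhds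
      simpa using this
  have h2 := h1.const_mul 2
  simp only [integral_zero, mul_zero] at h2
  refine h2.congr' ?_
  filter_upwards [self_mem_nhdsWithin] with θ hθ
  have e : ∀ z, |f z θ - f z θ₀| = (f z θ - f z θ₀) + 2 * max (f z θ₀ - f z θ) 0 := by
    intro z
    rcases le_total (f z θ) (f z θ₀) with h | h
    · rw [abs_of_nonpos (by linarith), max_eq_left (by linarith)]; ring
    · rw [abs_of_nonneg (by linarith), max_eq_right (by linarith)]; ring
  simp only [e]
  have i1 : Integrable (fun z => f z θ - f z θ₀) μ := (hint θ hθ).sub (hint θ₀ hθ₀)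
  have i2 : Integrable (fun z => 2 * max (f z θ₀ - f z θ) 0) μ :=
    ((hint θ₀ hθ₀).sub (hint θ hθ)).pos_part.const_mul 2
  rw [integral_add i1 i2, integral_sub (hint θ hθ) (hint θ₀ hθ₀), hprob θ hθ, hprob θ₀ hθ₀, integral_const_mul]
  ring

/-- Bias. -/
lemma bias_aux {E : Type*} [MeasurableSpace E] (μ : Measure E)
    (a b : E → ℝ) (ha : Measurable a) (hb : Measurable b)
    (ha0 : ∀ z, 0 < a z) (hb0 : ∀ z, 0 < b z)
    (hai : Integrable a μ) (hbi : Integrable b μ)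
    (ν₁ ν₂ : Measure E) (h₁ : ν₁ = μ.withDensity fun z => ENNReal.ofReal (a z))
    (h₂ : ν₂ = μ.withDensity fun z => ENNReal.ofReal (b z))
    (g : E → ℝ) (hg : Measurable g) (K : ℝ)
    (hi₁ : Integrable (fun z => g z ^ 2) ν₁) (hK₁ : ∫ z, g z ^ 2 ∂ν₁ ≤ K)
    (hi₂ : Integrable (fun z => g z ^ 2) ν₂) (hK₂ : ∫ z, g z ^ 2 ∂ν₂ ≤ K)
    (hg₁ : Integrable g ν₁) (hg₂ : Integrable g ν₂)
    (M : ℝ) (hM : 0 < M) :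
    |∫ z, g z ∂ν₁ - ∫ z, g z ∂ν₂| ≤ M * ∫ z, |a z - b z| ∂μ + 2 * K / M := by
  have key : ∀ (a : E → ℝ), Measurable a → (∀ z, 0 < a z) → ∀ h : E → ℝ,
      Integrable h (μ.withDensity fun z => ENNReal.ofReal (a z)) →
      Integrable (fun z => a z * h z) μ ∧
      ∫ z, h z ∂(μ.withDensity fun z => ENNReal.ofReal (a z)) = ∫ z, a z * h z ∂μ := by
    intro a ha ha0 h hh
    have ht : ∀ᵐ z ∂μ, ENNReal.ofReal (a z) < ⊤ :=
      Eventually.of_forall fun z => ENNReal.ofReal_lt_top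
    rw [integrable_withDensity_iff_integrable_smul' ha.ennreal_ofReal ht] at hh
    rw [integral_withDensity_eq_integral_toReal_smul ha.ennreal_ofReal ht]
    simp only [ENNReal.toReal_ofReal (ha0 _).le, smul_eq_mul] at hh ⊢
    exact ⟨hh, trivial⟩
  subst h₁ h₂
  obtain ⟨i1, e1⟩ := key a ha ha0 g hg₁
  obtain ⟨i2, e2⟩ := key b hb hb0 g hg₂
  obtain ⟨i3, e3⟩ := key a ha ha0 _ hi₁
  obtain ⟨i4, e4⟩ := key b hb hb0 _ hi₂
  rw [e3] at hK₁
  rw [e4] at hK₂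
  rw [e1, e2, ← integral_sub i1 i2]
  have hle : ∀ z, |a z * g z - b z * g z| ≤
      M * |a z - b z| + M⁻¹ * (a z * g z ^ 2 + b z * g z ^ 2) := by
    intro z
    have h1 : |g z| ≤ M + M⁻¹ * g z ^ 2 := by
      have : 0 ≤ M⁻¹ * (|g z| - M) ^ 2 + |g z| := by positivity
      have e : M⁻¹ * (|g z| - M) ^ 2 = M⁻¹ * g z ^ 2 - 2 * |g z| + M := by
        rw [← sq_abs (g z)]; field_simp; ring
      linarith
    have h2 : |a z - b z| ≤ a z + b z :=
      abs_le.2 ⟨by linarith [ha0 z, hb0 z], by linarith [ha0 z, hb0 z]⟩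
    calc |a z * g z - b z * g z| = |a z - b z| * |g z| := by rw [← sub_mul, abs_mul]
      _ ≤ |a z - b z| * (M + M⁻¹ * g z ^ 2) := by gcongr
      _ = M * |a z - b z| + |a z - b z| * (M⁻¹ * g z ^ 2) := by ring
      _ ≤ M * |a z - b z| + (a z + b z) * (M⁻¹ * g z ^ 2) := by gcongr
      _ = _ := by ring
  calc |∫ z, a z * g z - b z * g z ∂μ| ≤ ∫ z, |a z * g z - b z * g z| ∂μ :=
        abs_integral_le_integral_abs
    _ ≤ ∫ z, (M * |a z - b z| + M⁻¹ * (a z * g z ^ 2 + b z * g z ^ 2)) ∂μ :=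
        integral_mono (i1.sub i2).abs
          (((hai.sub hbi).abs.const_mul M).add ((i3.add i4).const_mul _)) hle
    _ = M * ∫ z, |a z - b z| ∂μ + M⁻¹ * (∫ z, a z * g z ^ 2 ∂μ + ∫ z, b z * g z ^ 2 ∂μ) := by
        have i5 : Integrable (fun z => M * |a z - b z|) μ := (hai.sub hbi).abs.const_mul M
        have i6 : Integrable (fun z => M⁻¹ * (a z * g z ^ 2 + b z * g z ^ 2)) μ :=
          (i3.add i4).const_mul _
        rw [integral_add i5 i6,
          integral_const_mul, integral_const_mul, integral_add i3 i4]
    _ ≤ M * ∫ z, |a z - b z| ∂μ + M⁻¹ * (K + K) := by gcongr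
    _ = _ := by field_simp; ring

/-- Modulus of continuity, measurable version. -/
lemma modulus_aux {E T : Type*} [MeasurableSpace E] [MetricSpace T] [CompactSpace T] [Nonempty T]
    (ℓ : E → T → ℝ) (hc : ∀ z, Continuous (ℓ z)) (hm : ∀ t, Measurable fun z => ℓ z t) :
    ∃ W : ℕ → E → ℝ, (∀ k, Measurable (W k)) ∧ (∀ k z, 0 ≤ W k z) ∧
      (∀ k z, W k z ≤ 2 * √(⨆ t, ℓ z t ^ 2)) ∧
      (∀ (k : ℕ) z s t, dist s t < 1 / ((k : ℝ) + 1) → |ℓ z s - ℓ z t| ≤ W k z) ∧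
      ∀ z, Tendsto (fun k => W k z) atTop (nhds 0) := by
  classical
  let D := TopologicalSpace.denseSeq T
  have hD : DenseRange D := TopologicalSpace.denseRange_denseSeq T
  let F : ℕ → ℕ × ℕ → E → ℝ := fun k p z =>
    if dist (D p.1) (D p.2) < 1 / ((k : ℝ) + 1) then |ℓ z (D p.1) - ℓ z (D p.2)| else 0
  have hF0 : ∀ k p z, 0 ≤ F k p z := by
    intro k p z
    simp only [F]
    split_ifs
    · exact abs_nonneg _
    · exact le_rfl
  have hbd : ∀ z, BddAbove (Set.range fun t => ℓ z t ^ 2) := fun z =>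
    (isCompact_range ((hc z).pow 2)).bddAbove
  have hle : ∀ z t, |ℓ z t| ≤ √(⨆ t, ℓ z t ^ 2) := by
    intro z t
    rw [← Real.sqrt_sq_eq_abs]
    exact Real.sqrt_le_sqrt (le_ciSup (hbd z) t)
  have hFle : ∀ k p z, F k p z ≤ 2 * √(⨆ t, ℓ z t ^ 2) := by
    intro k p z
    simp only [F]
    split_ifs
    · refine (abs_sub _ _).trans ?_
      linarith [hle z (D p.1), hle z (D p.2)]
    · positivity
  have hFb : ∀ k z, BddAbove (Set.range fun p => F k p z) := by
    rintro k z
    refine ⟨2 * √(⨆ t, ℓ z t ^ 2), ?_⟩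
    rintro _ ⟨p, rfl⟩
    exact hFle k p z
  refine ⟨fun k z => ⨆ p, F k p z, ?_, ?_, ?_, ?_, ?_⟩
  · intro k
    refine Measurable.iSup fun p => ?_
    simp only [F]
    split_ifs
    · exact continuous_abs.measurable.comp ((hm _).sub (hm _))
    · exact measurable_const
  · exact fun k z => Real.iSup_nonneg fun p => hF0 k p z
  · exact fun k z => ciSup_le fun p => hFle k p z
  · intro k z s t hst
    have hD2 : DenseRange (Prod.map D D) := hD.prodMap hD
    have hU : IsOpen {x : T × T | dist x.1 x.2 < 1 / ((k : ℝ) + 1)} :=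
      isOpen_lt continuous_dist continuous_const
    have hC : IsClosed {x : T × T | |ℓ z x.1 - ℓ z x.2| ≤ ⨆ p, F k p z} :=
      isClosed_le ((((hc z).comp continuous_fst).sub ((hc z).comp continuous_snd)).abs)
        continuous_const
    have hmem := Dense.open_subset_closure_inter hD2 hU (show (s, t) ∈ _ from hst)
    refine closure_minimal ?_ hC hmem
    rintro _ ⟨hx, ⟨p, rfl⟩⟩
    have := le_ciSup (hFb k z) p
    simp only [F] at this
    rw [if_pos (by simpa using hx)] at this
    exact this
  · intro z
    rw [Metric.tendsto_atTop]
    intro κ hκ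
    obtain ⟨δ, hδ, h⟩ := Metric.uniformContinuous_iff.1
      (CompactSpace.uniformContinuous_of_continuous (hc z)) (κ / 2) (by positivity)
    obtain ⟨n, hn⟩ := exists_nat_one_div_lt hδ
    refine ⟨n, fun k hk => ?_⟩
    rw [Real.dist_0_eq_abs, abs_of_nonneg (Real.iSup_nonneg fun p => hF0 k p z)]
    refine lt_of_le_of_lt (ciSup_le fun p => ?_) (half_lt_self hκ)
    simp only [F]
    split_ifs with hp
    · have : (1 : ℝ) / (k + 1) ≤ 1 / (n + 1) := by gcongr
      have := h (hp.trans (this.trans_lt hn))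
      rw [Real.dist_eq] at this
      exact this.le
    · positivity

theorem stmt_16 {q J : ℕ}
    (Θ : Set (EuclideanSpace ℝ (Fin q)))
    (hΘcomp : IsCompact Θ) (hΘconv : Convex ℝ Θ)
    (θ₀ : EuclideanSpace ℝ (Fin q)) (hθ₀ : θ₀ ∈ Θ)
    (μ : Measure (Fin J → ℝ)) [SigmaFinite μ]
    (f : (Fin J → ℝ) → EuclideanSpace ℝ (Fin q) → ℝ)
    [∀ θ, SigmaFinite (densMeasure μ f θ)]
    (hmeas : Measurable (Function.uncurry f))
    (hpos : ∀ z θ, 0 < f z θ)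
    (hprob : ∀ θ ∈ Θ, ∫ z, f z θ ∂μ = 1)
    (hdiff : ∀ z, ContDiffOn ℝ 1 (f z) Θ)
    (hmom0 : ∃ C : ℝ, ∀ θ' ∈ Θ,
      ∫⁻ z, ENNReal.ofReal (⨆ θ : Θ, (Real.log (f z θ)) ^ 2)
        ∂(densMeasure μ f θ') ≤ ENNReal.ofReal C)
    (hmom1 : ∃ C : ℝ, ∀ θ' ∈ Θ,
      ∫⁻ z, ENNReal.ofReal
          (⨆ θ : Θ, ‖fderivWithin ℝ (fun θ'' => Real.log (f z θ'')) Θ θ‖ ^ 2)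
        ∂(densMeasure μ f θ') ≤ ENNReal.ofReal C)
    (hcont : ContinuousOn
      (fun θ => ∫ z, Real.log (f z θ) ∂(densMeasure μ f θ₀)) Θ)
    -- the random bootstrap parameter, consistent for θ₀
    {Ω : Type*} [MeasurableSpace Ω] (P : Measure Ω) [IsProbabilityMeasure P]
    (θstar : ℕ → Ω → EuclideanSpace ℝ (Fin q))
    (hθstarmeas : ∀ N, Measurable (θstar N))
    (hθstarmem : ∀ N ω, θstar N ω ∈ Θ)
    (hθstarcons : ∀ ε : ℝ, 0 < ε →
      Tendsto (fun N => P {ω | ε ≤ dist (θstar N ω) θ₀}) atTop (nhds 0)) :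
    ∀ ε : ℝ, 0 < ε → ∀ η : ℝ, 0 < η →
      Tendsto (fun N =>
          P {ω | ENNReal.ofReal η <
            (bootLaw μ f N (θstar N ω)) {ys | ε <
              ⨆ θ : Θ, |(N : ℝ)⁻¹ * ∑ i : Fin N, Real.log (f (ys i) θ) -
                ∫ z, Real.log (f z θ) ∂(densMeasure μ f θ₀)|}})
        atTop (nhds 0) := by
  classical
  haveI : Nonempty Θ := ⟨⟨θ₀, hθ₀⟩⟩
  haveI : CompactSpace Θ := isCompact_iff_compactSpace.1 hΘcomp
  obtain ⟨C, hC⟩ := hmom0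
  set K : ℝ := 4 * max C 0 with hKdef
  have hK0 : 0 ≤ K := by positivity
  have hfc : ∀ z, ContinuousOn (f z) Θ := fun z => (hdiff z).continuousOn
  have hfm : ∀ θ, Measurable fun z => f z θ := fun θ =>
    hmeas.comp (measurable_id.prodMk measurable_const)
  let ℓ : (Fin J → ℝ) → Θ → ℝ := fun z t => Real.log (f z t)
  have hlc : ∀ z, Continuous (ℓ z) := fun z =>
    (continuousOn_iff_continuous_restrict.1 (hfc z)).log fun t => (hpos z t).ne'
  have hlm : ∀ t, Measurable fun z => ℓ z t := fun t => (hfm t).log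
  obtain ⟨W, hWm, hW0, hWle, hWmod, hWlim⟩ := modulus_aux ℓ hlc hlm
  have hbd : ∀ z, BddAbove (Set.range fun t => ℓ z t ^ 2) := fun z =>
    (isCompact_range ((hlc z).pow 2)).bddAbove
  have hS0 : ∀ z, 0 ≤ ⨆ t, ℓ z t ^ 2 := fun z => Real.iSup_nonneg fun t => sq_nonneg _
  have hint : ∀ θ ∈ Θ, Integrable (fun z => f z θ) μ := by
    intro θ hθ
    exact .of_integral_ne_zero (by rw [hprob θ hθ]; exact one_ne_zero)
  have hP : ∀ θ ∈ Θ, IsProbabilityMeasure (densMeasure μ f θ) := by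
    intro θ hθ
    constructor
    rw [densMeasure, withDensity_apply _ MeasurableSet.univ, Measure.restrict_univ,
      ← ofReal_integral_eq_lintegral_ofReal (hint θ hθ)
        (Eventually.of_forall fun z => (hpos z θ).le), hprob θ hθ, ENNReal.ofReal_one]
  have hSq : ∀ θ ∈ Θ, ∀ g : (Fin J → ℝ) → ℝ, Measurable g →
      (∀ z, g z ^ 2 ≤ 4 * ⨆ t, ℓ z t ^ 2) →
      Integrable (fun z => g z ^ 2) (densMeasure μ f θ) ∧
        ∫ z, g z ^ 2 ∂(densMeasure μ f θ) ≤ K := by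
    intro θ hθ g hg hgS
    refine sqInt_aux _ g hg K hK0 ?_
    calc ∫⁻ z, ENNReal.ofReal (g z ^ 2) ∂(densMeasure μ f θ)
        ≤ ∫⁻ z, ENNReal.ofReal 4 * ENNReal.ofReal (⨆ t, ℓ z t ^ 2) ∂(densMeasure μ f θ) := by
          refine lintegral_mono fun z => ?_
          rw [← ENNReal.ofReal_mul (by norm_num)]
          exact ENNReal.ofReal_le_ofReal (hgS z)
      _ = ENNReal.ofReal 4 * ∫⁻ z, ENNReal.ofReal (⨆ t, ℓ z t ^ 2) ∂(densMeasure μ f θ) :=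
          lintegral_const_mul' _ _ ENNReal.ofReal_ne_top
      _ ≤ ENNReal.ofReal 4 * ENNReal.ofReal (max C 0) := by
          gcongr
          exact (hC θ hθ).trans (ENNReal.ofReal_le_ofReal (le_max_left _ _))
      _ = ENNReal.ofReal K := by rw [← ENNReal.ofReal_mul (by norm_num)]
  have hI : ∀ θ ∈ Θ, ∀ g : (Fin J → ℝ) → ℝ, Measurable g →
      (∀ z, g z ^ 2 ≤ 4 * ⨆ t, ℓ z t ^ 2) → Integrable g (densMeasure μ f θ) := by
    intro θ hθ g hg hgS
    haveI := hP θ hθ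
    exact ((memLp_two_iff_integrable_sq hg.aestronglyMeasurable).2
      (hSq θ hθ g hg hgS).1).integrable (by norm_num)
  have hsq : ∀ z (x : ℝ), 0 ≤ x → x ≤ 2 * √(⨆ t, ℓ z t ^ 2) →
      x ^ 2 ≤ 4 * ⨆ t, ℓ z t ^ 2 := by
    intro z x hx hx'
    calc x ^ 2 ≤ (2 * √(⨆ t, ℓ z t ^ 2)) ^ 2 := by gcongr
      _ = _ := by rw [mul_pow, Real.sq_sqrt (hS0 z)]; norm_num
  have hWsq : ∀ k z, W k z ^ 2 ≤ 4 * ⨆ t, ℓ z t ^ 2 := fun k z =>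
    hsq z _ (hW0 k z) (hWle k z)
  have hlsq : ∀ t z, ℓ z t ^ 2 ≤ 4 * ⨆ t, ℓ z t ^ 2 := fun t z => by
    have := le_ciSup (hbd z) t
    linarith [hS0 z]
  -- uniform bias bound
  have hbias : ∀ κ : ℝ, 0 < κ → ∃ δ > 0, ∀ θ ∈ Θ, dist θ θ₀ < δ →
      ∀ g : (Fin J → ℝ) → ℝ, Measurable g → (∀ z, g z ^ 2 ≤ 4 * ⨆ t, ℓ z t ^ 2) →
      |∫ z, g z ∂(densMeasure μ f θ) - ∫ z, g z ∂(densMeasure μ f θ₀)| ≤ κ := by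
    intro κ hκ
    have hsch := scheffe_aux μ f Θ θ₀ hθ₀ hpos hint hprob hfc
    set M : ℝ := 4 * (K + 1) / κ with hM
    have hM0 : 0 < M := by positivity
    have hev := hsch.eventually (gt_mem_nhds (show (0 : ℝ) < κ / (2 * M) by positivity))
    obtain ⟨δ, hδ, hball⟩ := Metric.mem_nhdsWithin_iff.1 hev
    refine ⟨δ, hδ, fun θ hθ hd g hg hgS => ?_⟩
    have h1 : ∫ z, |f z θ - f z θ₀| ∂μ < κ / (2 * M) := hball ⟨hd, hθ⟩
    have hb := bias_aux μ (fun z => f z θ) (fun z => f z θ₀) (hfm θ) (hfm θ₀)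
      (fun z => hpos z θ) (fun z => hpos z θ₀) (hint θ hθ) (hint θ₀ hθ₀)
      (densMeasure μ f θ) (densMeasure μ f θ₀) rfl rfl g hg K
      (hSq θ hθ g hg hgS).1 (hSq θ hθ g hg hgS).2
      (hSq θ₀ hθ₀ g hg hgS).1 (hSq θ₀ hθ₀ g hg hgS).2
      (hI θ hθ g hg hgS) (hI θ₀ hθ₀ g hg hgS) M hM0
    refine hb.trans ?_
    have h2 : M * ∫ z, |f z θ - f z θ₀| ∂μ ≤ κ / 2 := by
      calc M * ∫ z, |f z θ - f z θ₀| ∂μ ≤ M * (κ / (2 * M)) := by gcongr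
        _ = κ / 2 := by field_simp
    have h3 : 2 * K / M ≤ κ / 2 := by
      rw [div_le_iff₀ hM0, hM]
      have : κ / 2 * (4 * (K + 1) / κ) = 2 * (K + 1) := by field_simp; ring
      rw [this]; linarith
    linarith
  -- the modulus has small expectation
  have hEW : Tendsto (fun k => ∫ z, W k z ∂(densMeasure μ f θ₀)) atTop (nhds 0) := by
    have hWb : ∀ z, BddAbove (Set.range fun k => W k z) := by
      intro z
      refine ⟨2 * √(⨆ t, ℓ z t ^ 2), ?_⟩
      rintro _ ⟨k, rfl⟩
      exact hWle k z
    have hB : Integrable (fun z => ⨆ k, W k z) (densMeasure μ f θ₀) :=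
      hI θ₀ hθ₀ _ (Measurable.iSup hWm) fun z =>
        hsq z _ (Real.iSup_nonneg fun k => hW0 k z) (ciSup_le fun k => hWle k z)
    have := tendsto_integral_of_dominated_convergence (μ := densMeasure μ f θ₀)
      (F := W) (f := fun _ => (0 : ℝ)) (fun z => ⨆ k, W k z)
      (fun k => (hWm k).aestronglyMeasurable) hB
      (fun k => Eventually.of_forall fun z => by
        rw [Real.norm_of_nonneg (hW0 k z)]; exact le_ciSup (hWb z) k)
      (Eventually.of_forall hWlim)
    simpa using this
  intro ε hε η hη
  set κ : ℝ := min (ε / 4) (ε * η / 16) with hκdef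
  have hκ : 0 < κ := by positivity
  have hκ1 : κ ≤ ε / 4 := min_le_left _ _
  have hκ2 : κ ≤ ε * η / 16 := min_le_right _ _
  obtain ⟨k, hk⟩ := (hEW.eventually (gt_mem_nhds hκ)).exists
  obtain ⟨δ, hδ, hδb⟩ := hbias κ hκ
  obtain ⟨net, -, hnetfin, hnet⟩ := Metric.finite_approx_of_totallyBounded
    (isCompact_univ (X := Θ)).totallyBounded (1 / ((k : ℝ) + 1)) (by positivity)
  lift net to Finset Θ using hnetfin
  have hdet : ∀ᶠ N : ℕ in atTop, ∀ θ ∈ Θ, dist θ θ₀ < δ →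
      (bootLaw μ f N θ) {ys | ε < ⨆ θ : Θ, |(N : ℝ)⁻¹ * ∑ i : Fin N, Real.log (f (ys i) θ) -
                ∫ z, Real.log (f z θ) ∂(densMeasure μ f θ₀)|} ≤ ENNReal.ofReal η := by
    have hlim : Tendsto (fun N : ℕ => (net.card : ℝ) * (K / (N * (ε / 4) ^ 2))) atTop (nhds 0) := by
      have h1 : Tendsto (fun N : ℕ => (N : ℝ) * (ε / 4) ^ 2) atTop atTop :=
        tendsto_natCast_atTop_atTop.atTop_mul_const (by positivity)
      simpa using (h1.const_div_atTop K).const_mul (net.card : ℝ)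
    filter_upwards [hlim.eventually (gt_mem_nhds (show (0 : ℝ) < η / 2 by positivity)),
      eventually_gt_atTop 0] with N hN hN0 θ hθ hd
    haveI := hP θ hθ
    have hN' : (0 : ℝ) < N := by exact_mod_cast hN0
    have hsub : {ys : Fin N → Fin J → ℝ | ε < ⨆ θ : Θ,
        |(N : ℝ)⁻¹ * ∑ i : Fin N, Real.log (f (ys i) θ) -
          ∫ z, Real.log (f z θ) ∂(densMeasure μ f θ₀)|} ⊆
        {ys | ε / 4 ≤ (N : ℝ)⁻¹ * ∑ i, W k (ys i)} ∪
        ⋃ t ∈ net, {ys | ε / 4 ≤ |(N : ℝ)⁻¹ * ∑ i, ℓ (ys i) t -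
          ∫ z, ℓ z t ∂(densMeasure μ f θ)|} := by
      intro ys hys
      by_contra hcon
      simp only [Set.mem_union, Set.mem_iUnion, Set.mem_ofPred_eq, not_or, not_exists,
        not_le] at hcon hys
      obtain ⟨hc1, hc2⟩ := hcon
      obtain ⟨s, hs⟩ := exists_lt_of_lt_ciSup hys
      obtain ⟨t, ht, hst⟩ : ∃ t ∈ net, dist s t < 1 / ((k : ℝ) + 1) := by
        have := hnet (Set.mem_univ s)
        simpa using this
      have a1 : |(N : ℝ)⁻¹ * ∑ i, ℓ (ys i) s - (N : ℝ)⁻¹ * ∑ i, ℓ (ys i) t| ≤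
          (N : ℝ)⁻¹ * ∑ i, W k (ys i) := by
        rw [← mul_sub, ← Finset.sum_sub_distrib, abs_mul, abs_of_pos (inv_pos.2 hN')]
        gcongr
        refine (Finset.abs_sum_le_sum_abs _ _).trans (Finset.sum_le_sum fun i _ => ?_)
        exact hWmod k (ys i) s t hst
      have a2 := hc2 t ht
      have a3 := hδb θ hθ hd (fun z => ℓ z t) (hlm t) (hlsq t)
      have a4 : |∫ z, ℓ z s ∂(densMeasure μ f θ₀) - ∫ z, ℓ z t ∂(densMeasure μ f θ₀)| ≤
          ∫ z, W k z ∂(densMeasure μ f θ₀) := by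
        have is := hI θ₀ hθ₀ _ (hlm s) (hlsq s)
        have it := hI θ₀ hθ₀ _ (hlm t) (hlsq t)
        rw [← integral_sub is it]
        exact abs_integral_le_integral_abs.trans (integral_mono (is.sub it).abs
          (hI θ₀ hθ₀ _ (hWm k) (hWsq k)) fun z => hWmod k z s t hst)
      change ε < |(N : ℝ)⁻¹ * ∑ i, ℓ (ys i) s - ∫ z, ℓ z s ∂(densMeasure μ f θ₀)| at hs
      have b1 := abs_le.1 a1
      have b2 := abs_lt.1 a2
      have b3 := abs_le.1 a3
      have b4 := abs_le.1 a4
      rcases lt_abs.1 hs with h | h <;> linarith [b1.1, b1.2, b2.1, b2.2, b3.1, b3.2, b4.1, b4.2]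
    have hWi := hI θ hθ _ (hWm k) (hWsq k)
    have hm1 := markov_aux (densMeasure μ f θ) (W k) hWi (hW0 k) N hN0 (ε / 4) (by positivity)
    have hWb := (abs_le.1 (hδb θ hθ hd (W k) (hWm k) (hWsq k))).2
    have hm2 : (∫ z, W k z ∂(densMeasure μ f θ)) / (ε / 4) ≤ η / 2 := by
      rw [div_le_iff₀ (by positivity)]
      linarith
    have hch : ∀ t ∈ net, (bootLaw μ f N θ) {ys | ε / 4 ≤ |(N : ℝ)⁻¹ * ∑ i, ℓ (ys i) t -
          ∫ z, ℓ z t ∂(densMeasure μ f θ)|} ≤ ENNReal.ofReal (K / (N * (ε / 4) ^ 2)) :=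
      fun t _ => cheb_aux (densMeasure μ f θ) (fun z => ℓ z t) (hlm t) K
        (hSq θ hθ _ (hlm t) (hlsq t)).1 (hSq θ hθ _ (hlm t) (hlsq t)).2 N hN0 (ε / 4)
        (by positivity)
    calc _ ≤ _ := measure_mono hsub
      _ ≤ _ := measure_union_le _ _
      _ ≤ ENNReal.ofReal (η / 2) + ENNReal.ofReal (η / 2) := by
        refine add_le_add (hm1.trans (ENNReal.ofReal_le_ofReal hm2)) ?_
        refine (measure_biUnion_finset_le _ _).trans ((Finset.sum_le_sum hch).trans ?_)
        rw [Finset.sum_const, nsmul_eq_mul, ← ENNReal.ofReal_natCast,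
          ← ENNReal.ofReal_mul (by positivity)]
        exact ENNReal.ofReal_le_ofReal hN.le
      _ = ENNReal.ofReal η := by
        rw [← ENNReal.ofReal_add (by positivity) (by positivity), add_halves]
  refine tendsto_of_tendsto_of_tendsto_of_le_of_le' tendsto_const_nhds (hθstarcons δ hδ)
    (Eventually.of_forall fun N => zero_le) ?_
  filter_upwards [hdet] with N hN
  refine measure_mono fun ω hω => ?_
  by_contra hcon
  simp only [Set.mem_ofPred_eq, not_le] at hcon hω
  exact absurd (hN _ (hθstarmem N ω) hcon) (not_le.2 hω)
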